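/- Let q be a prime power, K a finite field with q elements, K̄ an algebraic closure of K, and φ the Frobenius map on P¹(K̄) given by [a : b] ↦ [a^q : b^q]. The number of ordered 6-tuples (x₁, …, x₆) of pairwise distinct points of P¹(K̄) satisfying φ(x₁) = x₂, φ(x₂) = x₃, φ(x₃) = x₄, φ(x₄) = x₅, φ(x₅) = x₁ and φ(x₆) = x₆ equals (q + 1)(q⁵ − q). -/

import Mathlib

open Projectivization

/-- The Frobenius map on the projective line `P¹(L)`, acting in homogeneous coordinates by
`[a : b] ↦ [a ^ q : b ^ q]`. -/
noncomputable def frobP1 {L : Type*} [Field L] (q : ℕ)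
    (x : Projectivization L (Fin 2 → L)) : Projectivization L (Fin 2 → L) :=
  Projectivization.mk L (fun i => (x.rep i) ^ q) (by
    intro hzero
    obtain ⟨i, hi⟩ := Function.ne_iff.mp x.rep_nonzero
    have h2 : x.rep i ^ q = 0 := congrFun hzero i
    exact hi (by simpa using (pow_eq_zero_iff'.mp h2).1))

open Function

/-- `frobP1` may be computed on any representative. -/
theorem frobP1_mk {L : Type*} [Field L] (q : ℕ) (v : Fin 2 → L) (hv : v ≠ 0)
    (hvq : (fun i => v i ^ q) ≠ 0) :
    frobP1 q (Projectivization.mk L v hv) = Projectivization.mk L (fun i => v i ^ q) hvq := by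
  obtain ⟨a, ha⟩ := Projectivization.exists_smul_eq_mk_rep L v hv
  rw [frobP1, Projectivization.mk_eq_mk_iff']
  refine ⟨(a : L) ^ q, ?_⟩
  ext i
  simp [← ha, Units.smul_def, mul_pow]

/-- The affine chart `a ↦ [a : 1]` of the projective line, extended by `∞ ↦ [1 : 0]`. -/
noncomputable def optionToP1 {L : Type*} [Field L] :
    Option L → Projectivization L (Fin 2 → L)
  | none => Projectivization.mk L ![1, 0] (fun h => one_ne_zero (congrFun h 0))
  | some a => Projectivization.mk L ![a, 1] (fun h => one_ne_zero (congrFun h 1))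

theorem optionToP1_bijective {L : Type*} [Field L] : Bijective (optionToP1 (L := L)) := by
  constructor
  · rintro (_ | a) (_ | b) h
    · rfl
    all_goals
      obtain ⟨c, hc⟩ := (Projectivization.mk_eq_mk_iff' L _ _ _ _).mp h
      have h0 := congrFun hc 0
      have h1 := congrFun hc 1
      simp_all
  · intro x
    induction x using Projectivization.ind with
    | h v hv =>
      by_cases h1 : v 1 = 0
      · have h0 : v 0 ≠ 0 := fun h0 => hv (by ext i; fin_cases i <;> simp [h0, h1])
        refine ⟨none, (Projectivization.mk_eq_mk_iff' L _ _ _ _).mpr ⟨(v 0)⁻¹, ?_⟩⟩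
        ext i
        fin_cases i <;> simp [h0, h1]
      · refine ⟨some (v 0 / v 1), (Projectivization.mk_eq_mk_iff' L _ _ _ _).mpr ⟨(v 1)⁻¹, ?_⟩⟩
        ext i
        fin_cases i <;> simp [h1, div_eq_inv_mul]

theorem semiconj_optionToP1 {L : Type*} [Field L] {q : ℕ} (hq : q ≠ 0) :
    Semiconj (optionToP1 (L := L)) (Option.map (· ^ q)) (frobP1 q) := by
  rintro (_ | a)
  · have h : (fun i => (![1, 0] : Fin 2 → L) i ^ q) = ![1, 0] := by
      ext i
      fin_cases i <;> simp [hq]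
    refine Eq.symm ((frobP1_mk q _ _ (fun h0 => ?_)).trans ?_)
    · simpa using congrFun h0 0
    · simp only [h]
      rfl
  · have h : (fun i => (![a, 1] : Fin 2 → L) i ^ q) = ![a ^ q, 1] := by
      ext i
      fin_cases i <;> simp
    refine Eq.symm ((frobP1_mk q _ _ (fun h0 => ?_)).trans ?_)
    · simpa using congrFun h0 1
    · simp only [h]
      rfl

theorem Function.Semiconj.ncard_fixedPoints_eq {α β : Type*} {e : α → β} {f : α → α} {g : β → β}
    (h : Semiconj e f g) (he : Bijective e) : (fixedPoints g).ncard = (fixedPoints f).ncard := by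
  rw [← Set.ncard_image_of_injective _ he.injective]
  congr 1
  ext y
  obtain ⟨x, rfl⟩ := he.surjective y
  rw [he.injective.mem_set_image, mem_fixedPoints, mem_fixedPoints, IsFixedPt, IsFixedPt,
    ← h.eq, he.injective.eq_iff]

theorem fixedPoints_optionMap {α : Type*} (g : α → α) :
    fixedPoints (Option.map g) = insert none (some '' fixedPoints g) := by
  ext (_ | a) <;> simp [mem_fixedPoints, IsFixedPt]

theorem Option.map_iterate {α : Type*} (g : α → α) (n : ℕ) :
    (Option.map g)^[n] = Option.map g^[n] := by
  induction n with
  | zero => simp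
  | succ n ih => rw [iterate_succ, ih, iterate_succ, Option.map_comp_map]

theorem fixedPoints_pow_eq_rootSet {L : Type*} [Field L] {m : ℕ} (hm : 1 < m) :
    fixedPoints (fun a : L => a ^ m) =
      (Polynomial.X ^ m - Polynomial.X : Polynomial L).rootSet L := by
  ext a
  rw [Polynomial.mem_rootSet, and_iff_right (FiniteField.X_pow_card_sub_X_ne_zero L hm)]
  simp [mem_fixedPoints, IsFixedPt, sub_eq_zero]

theorem ncard_fixedPoints_pow {L : Type*} [Field L] [IsAlgClosed L] (p : ℕ) [CharP L p]
    {m : ℕ} (hm : 1 < m) (hpm : p ∣ m) : (fixedPoints (fun a : L => a ^ m)).ncard = m := by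
  rw [fixedPoints_pow_eq_rootSet hm, ← Nat.card_coe_set_eq, Nat.card_eq_fintype_card,
    Polynomial.card_rootSet_eq_natDegree (galois_poly_separable p m hpm) (IsAlgClosed.splits _),
    FiniteField.X_pow_card_sub_X_natDegree_eq L hm]

/-- The Frobenius map `φ` of the projective line satisfies `#Fix(φⁿ) = qⁿ + 1`. -/
theorem finite_and_ncard_fixedPoints_iterate_frobP1 {L : Type*} [Field L] [IsAlgClosed L] (p : ℕ)
    [CharP L p] {q : ℕ} (hq : 1 < q) (hpq : p ∣ q) {n : ℕ} (hn : n ≠ 0) :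
    (fixedPoints (frobP1 (L := L) q)^[n]).Finite ∧
      (fixedPoints (frobP1 (L := L) q)^[n]).ncard = q ^ n + 1 := by
  have hqn : 1 < q ^ n := Nat.one_lt_pow hn hq
  have hfin : (fixedPoints (fun a : L => a ^ q ^ n)).Finite :=
    Set.finite_of_ncard_ne_zero (by rw [ncard_fixedPoints_pow p hqn (dvd_pow hpq hn)]; lia)
  have hcard : (fixedPoints (frobP1 (L := L) q)^[n]).ncard = q ^ n + 1 := by
    rw [((semiconj_optionToP1 (by lia)).iterate_right n).ncard_fixedPoints_eq
      optionToP1_bijective, Option.map_iterate, pow_iterate, fixedPoints_optionMap,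
      Set.ncard_insert_of_notMem (by simp) (hfin.image _),
      Set.ncard_image_of_injective _ (Option.some_injective _),
      ncard_fixedPoints_pow p hqn (dvd_pow hpq hn)]
  exact ⟨Set.finite_of_ncard_ne_zero (by lia), hcard⟩

theorem injective_six_of_period_five {α : Type*} {f : α → α} {x : Fin 6 → α}
    (h0 : f (x 0) = x 1) (h1 : f (x 1) = x 2) (h2 : f (x 2) = x 3) (h3 : f (x 3) = x 4)
    (h4 : f (x 4) = x 0) (h5 : f (x 5) = x 5) (hne : x 1 ≠ x 0) : Injective x := by
  intro i j hij
  fin_cases i <;> fin_cases j <;> simp at hij ⊢ <;> grind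

/-- A 5-cycle of `f` together with a fixed point is determined by a point of the 5-cycle and
the fixed point. -/
def fiveCycleAndFixedPointEquiv {α : Type*} (f : α → α) :
    {x : Fin 6 → α // Injective x ∧ f (x 0) = x 1 ∧ f (x 1) = x 2 ∧ f (x 2) = x 3 ∧
      f (x 3) = x 4 ∧ f (x 4) = x 0 ∧ f (x 5) = x 5} ≃
    ↥(fixedPoints f^[5] \ fixedPoints f) × ↥(fixedPoints f) where
  toFun x := (⟨x.1 0, by
    obtain ⟨x, hx, h0, h1, h2, h3, h4, h5⟩ := x
    refine ⟨?_, fun h => ?_⟩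
    · simp [mem_fixedPoints, IsFixedPt, h0, h1, h2, h3, h4]
    · have h10 : x 1 = x 0 := h0.symm.trans h
      exact absurd (hx h10) (by decide)⟩, ⟨x.1 5, x.2.2.2.2.2.2.2⟩)
  invFun y := ⟨![y.1, f y.1, f (f y.1), f (f (f y.1)), f (f (f (f y.1))), y.2], by
    obtain ⟨⟨a, ha, hna⟩, b, hb⟩ := y
    exact ⟨injective_six_of_period_five (f := f) rfl rfl rfl rfl ha hb hna,
      rfl, rfl, rfl, rfl, ha, hb⟩⟩
  left_inv x := by
    obtain ⟨x, hx, h0, h1, h2, h3, h4, h5⟩ := x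
    ext i
    fin_cases i <;> simp [h0, h1, h2, h3]
  right_inv y := rfl

/-- the number of injective 6-tuples of points of `P¹(K̄)`
satisfying the stated Frobenius conditions. -/
theorem statement18 (q : ℕ) (hq : IsPrimePow q)
    (K : Type*) [Field K] [Fintype K] (hK : Fintype.card K = q) :
    (Nat.card
      {x : Fin 6 → Projectivization (AlgebraicClosure K) (Fin 2 → AlgebraicClosure K) //
        Function.Injective x ∧
        frobP1 q (x 0) = x 1 ∧
        frobP1 q (x 1) = x 2 ∧
        frobP1 q (x 2) = x 3 ∧
        frobP1 q (x 3) = x 4 ∧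
        frobP1 q (x 4) = x 0 ∧
        frobP1 q (x 5) = x 5} : ℤ)
    = ((q : ℤ) + 1) * ((q : ℤ) ^ 5 - (q : ℤ)) := by
  obtain ⟨p, hp⟩ := CharP.exists K
  have : CharP (AlgebraicClosure K) p := charP_of_injective_algebraMap' K p
  have hpq : p ∣ q := by
    rw [← CharP.cast_eq_zero_iff K p, ← hK, Nat.cast_card_eq_zero]
  obtain ⟨-, h1⟩ := finite_and_ncard_fixedPoints_iterate_frobP1 (L := AlgebraicClosure K) p
    hq.one_lt hpq one_ne_zero
  obtain ⟨hfin, h5⟩ := finite_and_ncard_fixedPoints_iterate_frobP1 (L := AlgebraicClosure K) p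
    hq.one_lt hpq (n := 5) (by norm_num)
  rw [iterate_one, pow_one] at h1
  have hsub : fixedPoints (frobP1 (L := AlgebraicClosure K) q) ⊆ fixedPoints (frobP1 q)^[5] :=
    fun x hx => IsFixedPt.iterate hx 5
  have hdiff := Set.ncard_sdiff_add_ncard_of_subset hsub hfin
  rw [Nat.card_congr (fiveCycleAndFixedPointEquiv _), Nat.card_prod, Nat.card_coe_set_eq,
    Nat.card_coe_set_eq, h1]
  rw [h1, h5] at hdiff
  zify at hdiff
  push_cast
  linear_combination ((q : ℤ) + 1) * hdiff
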